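/- Let G be a finite simple graph on n vertices (n ≥ 2) with minimum degree δ ≥ 3, and let k be an integer with 3 ≤ k ≤ δ. Then there exists an orientation D of G such that every vertex has out-degree at least 1 in D, and every directed simple path in D has at most χ(G) + k·⌈log_{δ−1} n⌉ + 2·⌈log_{k−1} n⌉ vertices. [Explicit form of the short-orientation lemma; taking k = max(3, ⌈log δ / log log δ⌉) yields paths of length at most χ(G) + O(log n / log log δ).] -/

import Mathlib

namespace ShortOrientation

open Finset

variable {V : Type} {G H : SimpleGraph V}

/-- The spanning subgraph of `G` keeping only the edges with both endpoints in `s`. -/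
def restrictTo (G : SimpleGraph V) (s : Set V) : SimpleGraph V where
  Adj a b := G.Adj a b ∧ a ∈ s ∧ b ∈ s
  symm := ⟨fun _ _ h => ⟨h.1.symm, h.2.2, h.2.1⟩⟩
  loopless := ⟨fun _ h => h.1.ne rfl⟩

lemma restrictTo_le (s : Set V) : restrictTo G s ≤ G := fun _ _ h => h.1

lemma exists_isCycle_of_two_predecessors {v w x y : V} {R : ℕ} (hxy : x ≠ y)
    (hx : H.Reachable v x) (hy : H.Reachable v y) (hxw : H.Adj x w) (hyw : H.Adj y w)
    (hdx : H.dist v x ≤ H.dist v w) (hdy : H.dist v y ≤ H.dist v w)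
    (hxR : H.dist v x < R) (hyR : H.dist v y < R) :
    ∃ (u : V) (c : H.Walk u u), c.IsCycle ∧ c.length ≤ 2 * R := by
  classical
  have key : ∀ z, H.Reachable v z → H.Adj z w → H.dist v z ≤ H.dist v w →
      ∃ p : H.Walk v w, p.IsPath ∧ p.length = H.dist v z + 1 ∧ p.penultimate = z := by
    intro z hz hzw hdz
    obtain ⟨p, hp, hpl⟩ := hz.exists_path_of_dist
    refine ⟨p.concat hzw, ?_, by simp [hpl], by simp⟩
    refine hp.concat ?_ hzw
    intro hw
    have h1 := SimpleGraph.dist_le (p.takeUntil w hw)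
    have h2 := p.length_takeUntil_lt_length hw hzw.ne'
    omega
  obtain ⟨p, hp, hpl, hpx⟩ := key x hx hxw hdx
  obtain ⟨q, hq, hql, hqy⟩ := key y hy hyw hdy
  have hne : p ≠ q := by
    rintro rfl
    exact hxy (hpx.symm.trans hqy)
  obtain ⟨u, -, -, c, hc, hcl⟩ := hp.exists_isCycle_length_le_add_of_ne hq hne
  exact ⟨u, c, hc, by omega⟩

/-- If all vertices at distance less than `R` from `v` have degree at least `d` and there are at
most `(d - 1) ^ R` vertices, then there is a cycle of length at most `2 * R`. -/
lemma exists_isCycle_length_le [Fintype V] [DecidableEq V] [DecidableRel H.Adj] (v : V) {d R : ℕ}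
    (hR : 0 < R) (hcard : Fintype.card V ≤ (d - 1) ^ R)
    (hdeg : ∀ x, H.Reachable v x → H.dist v x < R → d ≤ #{y | H.Adj x y}) :
    ∃ (u : V) (c : H.Walk u u), c.IsCycle ∧ c.length ≤ 2 * R := by
  classical
  by_contra hno
  let S : ℕ → Finset V := fun i => {x | H.Reachable v x ∧ H.dist v x = i}
  have grow : ∀ i, i < R → (d - 1) * #(S i) ≤ #(S (i + 1)) := by
    intro i hi
    have := Finset.card_mul_le_card_mul (s := S i) (t := S (i + 1)) H.Adj (m := d - 1) (n := 1)
      ?_ ?_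
    · simpa [mul_comm] using this
    · intro x hx
      simp only [S, mem_filter, mem_univ, true_and] at hx
      obtain ⟨hx, hxi⟩ := hx
      have h1 := hdeg x hx (by omega)
      have hreach : ∀ y, H.Adj x y → H.Reachable v y := fun y hy => hx.trans hy.reachable
      have hle : ∀ y, H.Adj x y → H.dist v y ≤ i + 1 := by
        intro y hy
        obtain ⟨p, hp⟩ := hx.exists_walk_length_eq_dist
        have := SimpleGraph.dist_le (p.concat hy)
        simp at this
        omega
      have h2 : #{y | H.Adj x y ∧ H.dist v y ≤ i} ≤ 1 := by
        rw [Finset.card_le_one]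
        intro a ha b hb
        simp only [mem_filter, mem_univ, true_and] at ha hb
        by_contra hab
        exact hno (exists_isCycle_of_two_predecessors hab (hreach a ha.1) (hreach b hb.1)
          ha.1.symm hb.1.symm (by omega) (by omega) (by omega) (by omega))
      have h3 : ({y | H.Adj x y} : Finset V) ⊆
          ({y | H.Adj x y ∧ H.dist v y ≤ i} : Finset V) ∪
            (S (i + 1)).bipartiteAbove H.Adj x := by
        intro y hy
        simp only [mem_filter, mem_univ, true_and] at hy
        have := hle y hy
        simp only [mem_union, mem_filter, mem_univ, true_and, mem_bipartiteAbove, S]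
        by_cases h : H.dist v y ≤ i
        · exact Or.inl ⟨hy, h⟩
        · exact Or.inr ⟨⟨hreach y hy, by omega⟩, hy⟩
      have h4 := (card_le_card h3).trans (card_union_le _ _)
      omega
    · intro w hw
      simp only [S, mem_filter, mem_univ, true_and] at hw
      rw [Finset.card_le_one]
      intro a ha b hb
      simp only [mem_bipartiteBelow, S, mem_filter, mem_univ, true_and] at ha hb
      by_contra hab
      exact hno (exists_isCycle_of_two_predecessors hab ha.1.1 hb.1.1 ha.2 hb.2
        (by omega) (by omega) (by omega) (by omega))
  have pow_le : ∀ i, i ≤ R → (d - 1) ^ i ≤ #(S i) := by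
    intro i
    induction i with
    | zero =>
      intro _
      have : v ∈ S 0 := by simp [S]
      simpa using Finset.card_pos.2 ⟨v, this⟩
    | succ i ih =>
      intro hi
      calc (d - 1) ^ (i + 1) = (d - 1) * (d - 1) ^ i := by ring
        _ ≤ (d - 1) * #(S i) := Nat.mul_le_mul_left _ (ih (by omega))
        _ ≤ _ := grow i (by omega)
  have hlt : #(S R) < Fintype.card V := by
    refine Finset.card_lt_univ_of_notMem (x := v) ?_
    simp [S]
    omega
  have := pow_le R le_rfl
  omega

/-- A degenerate graph is colorable. -/
lemma exists_coloring_of_degenerate [Fintype V] [DecidableEq V] [DecidableRel H.Adj] {k : ℕ}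
    (h : ∀ W : Finset V, W.Nonempty → ∃ w ∈ W, #{y ∈ W | H.Adj w y} < k) :
    ∃ c : V → ℕ, (∀ x, c x < k) ∧ ∀ x y, H.Adj x y → c x ≠ c y := by
  have main : ∀ W : Finset V, ∃ c : V → ℕ, (∀ x ∈ W, c x < k) ∧
      ∀ x ∈ W, ∀ y ∈ W, H.Adj x y → c x ≠ c y := by
    intro W
    induction W using Finset.strongInduction with
    | H W ih =>
      rcases W.eq_empty_or_nonempty with rfl | hW
      · exact ⟨fun _ => 0, by simp, by simp⟩
      obtain ⟨w, hw, hlt⟩ := h W hW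
      obtain ⟨c, hc, hproper⟩ := ih (W.erase w) (erase_ssubset hw)
      obtain ⟨j, hj, hjn⟩ : ∃ j ∈ range k, j ∉ ({y ∈ W | H.Adj w y} : Finset V).image c := by
        apply Finset.exists_mem_notMem_of_card_lt_card
        simpa using card_image_le.trans_lt hlt
      simp only [mem_range, mem_image, mem_filter, not_exists, not_and, and_imp] at hj hjn
      refine ⟨Function.update c w j, ?_, ?_⟩
      · intro x hx
        by_cases hxw : x = w
        · simpa [hxw] using hj
        · simpa [hxw] using hc x (mem_erase.2 ⟨hxw, hx⟩)
      · intro x hx y hy hxy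
        by_cases hxw : x = w
        · subst hxw
          simpa [hxy.ne'] using (hjn y hy hxy).imp Eq.symm
        · by_cases hyw : y = w
          · subst hyw
            simpa [hxw] using hjn x hx hxy.symm
          · simpa [hxw, hyw] using
              hproper x (mem_erase.2 ⟨hxw, hx⟩) y (mem_erase.2 ⟨hyw, hy⟩) hxy
  obtain ⟨c, hc, hp⟩ := main univ
  exact ⟨c, fun x => hc x (mem_univ x), fun x y => hp x (mem_univ x) y (mem_univ y)⟩

/-- `G` admits a partial orientation in which every vertex of `C` has an out-neighbour in `C`. -/
def OutOrientable (G : SimpleGraph V) (C : Finset V) : Prop :=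
  ∃ σ : V → V → Prop, (∀ a b, σ a b → G.Adj a b ∧ ¬ σ b a) ∧ ∀ a ∈ C, ∃ b ∈ C, σ a b

/-- Every simple path inside `C` has at most `M` vertices. -/
def PathBounded (G : SimpleGraph V) (M : ℕ) (C : Finset V) : Prop :=
  ∀ l : List V, l.Nodup → l.IsChain G.Adj → (∀ x ∈ l, x ∈ C) → l.length ≤ M

lemma outOrientable_support [DecidableEq V] {u : V} {c : G.Walk u u} (hc : c.IsCycle) :
    OutOrientable G c.support.toFinset := by
  refine ⟨fun a b => ∃ h : G.Adj a b, (⟨(a, b), h⟩ : G.Dart) ∈ c.darts, ?_, ?_⟩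
  · rintro a b ⟨h, hd⟩
    refine ⟨h, ?_⟩
    rintro ⟨h', hd'⟩
    have hnd : (c.darts.map SimpleGraph.Dart.edge).Nodup := hc.isTrail.edges_nodup
    have := List.inj_on_of_nodup_map hnd hd hd' (by simp [SimpleGraph.Dart.edge])
    simp only [SimpleGraph.Dart.mk.injEq, Prod.mk.injEq] at this
    exact h.ne this.1
  · have hfst : ∀ a ∈ c.support, ∃ d ∈ c.darts, d.fst = a := by
      have hu : ∃ d ∈ c.darts, d.fst = u :=
        ⟨c.firstDart hc.not_nil, c.firstDart_mem_darts hc.not_nil, rfl⟩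
      intro a ha
      rw [← c.map_fst_darts_append] at ha
      rcases List.mem_append.1 ha with ha | ha
      · simpa using List.mem_map.1 ha
      · rw [List.mem_singleton.1 ha]
        exact hu
    intro a ha
    obtain ⟨d, hd, rfl⟩ := hfst a (by simpa using ha)
    exact ⟨d.snd, by simpa using c.dart_snd_mem_support_of_mem_darts hd, d.adj, hd⟩

lemma card_support_le [DecidableEq V] {u : V} {c : G.Walk u u} (hc : c.IsCycle) :
    #c.support.toFinset ≤ c.length := by
  have : c.support.toFinset ⊆ c.support.tail.toFinset := by
    intro x hx
    rw [List.mem_toFinset] at hx ⊢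
    rw [SimpleGraph.Walk.mem_support_iff] at hx
    rcases hx with rfl | hx
    · exact c.end_mem_tail_support hc.not_nil
    · exact hx
  refine (card_le_card this).trans ((List.toFinset_card_le _).trans ?_)
  simp

lemma OutOrientable.union [DecidableEq V] {C S : Finset V} (hC : OutOrientable G C)
    (hS : OutOrientable G S) (hd : Disjoint C S) : OutOrientable G (C ∪ S) := by
  obtain ⟨σ, h1, h2⟩ := hC
  obtain ⟨τ, h3, h4⟩ := hS
  rw [Finset.disjoint_left] at hd
  refine ⟨fun a b => (a ∈ C ∧ σ a b ∧ b ∈ C) ∨ (a ∈ S ∧ τ a b ∧ b ∈ S), ?_, ?_⟩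
  · rintro a b (⟨ha, h, hb⟩ | ⟨ha, h, hb⟩)
    · refine ⟨(h1 a b h).1, ?_⟩
      rintro (h' | h')
      · exact (h1 a b h).2 h'.2.1
      · exact hd hb h'.1
    · refine ⟨(h3 a b h).1, ?_⟩
      rintro (h' | h')
      · exact hd h'.1 hb
      · exact (h3 a b h).2 h'.2.1
  · intro a ha
    rcases mem_union.1 ha with ha | ha
    · obtain ⟨b, hb, hab⟩ := h2 a ha
      exact ⟨b, mem_union_left _ hb, Or.inl ⟨ha, hab, hb⟩⟩
    · obtain ⟨b, hb, hab⟩ := h4 a ha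
      exact ⟨b, mem_union_right _ hb, Or.inr ⟨ha, hab, hb⟩⟩

lemma forall_mem_of_isChain {r : V → V → Prop} {p q : V → Prop}
    (h : ∀ a b, p a → q b → r a b → p b) :
    ∀ (l : List V) (a : V), (a :: l).IsChain r → p a → (∀ x ∈ l, q x) → ∀ x ∈ a :: l, p x := by
  intro l
  induction l with
  | nil => simp
  | cons b l ih =>
    intro a hch ha hq x hx
    rw [List.isChain_cons_cons] at hch
    rcases List.mem_cons.1 hx with rfl | hx
    · exact ha
    · exact ih b hch.2 (h a b ha (hq b (by simp)) hch.1)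
        (fun y hy => hq y (List.mem_cons_of_mem _ hy)) x hx

lemma PathBounded.union [DecidableEq V] {M : ℕ} {C S : Finset V} (hC : PathBounded G M C)
    (hS : #S ≤ M) (hadj : ∀ a ∈ C, ∀ b ∈ S, ¬ G.Adj a b) : PathBounded G M (C ∪ S) := by
  intro l hnd hch hl
  cases l with
  | nil => simp
  | cons a l =>
    rcases mem_union.1 (hl a (by simp)) with ha | ha
    · refine hC _ hnd hch (forall_mem_of_isChain (q := (· ∈ C ∪ S)) ?_ l a hch ha
        fun x hx => hl x (List.mem_cons_of_mem _ hx))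
      intro x y hx hy hxy
      exact (mem_union.1 hy).resolve_right fun h => hadj x hx y h hxy
    · have := forall_mem_of_isChain (p := (· ∈ S)) (q := (· ∈ C ∪ S)) ?_ l a hch ha
        fun x hx => hl x (List.mem_cons_of_mem _ hx)
      · rw [← List.toFinset_card_of_nodup hnd]
        exact (card_le_card fun x hx => this x (by simpa using hx)).trans hS
      · intro x y hx hy hxy
        exact (mem_union.1 hy).resolve_left fun h => hadj y h x hx hxy.symm

/-- There is a walk of length at most `i` from `x` to the set `C`. -/
def Near (G : SimpleGraph V) (C : Finset V) (i : ℕ) (x : V) : Prop :=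
  ∃ c ∈ C, ∃ p : G.Walk x c, p.length ≤ i

lemma near_zero {C : Finset V} {x : V} : Near G C 0 x ↔ x ∈ C := by
  constructor
  · rintro ⟨c, hc, p, hp⟩
    rwa [SimpleGraph.Walk.eq_of_length_eq_zero (Nat.le_zero.1 hp)]
  · exact fun h => ⟨x, h, .nil, by simp⟩

lemma Near.of_adj {C : Finset V} {x y : V} {i : ℕ} (h : Near G C i y) (hxy : G.Adj x y) :
    Near G C (i + 1) x := by
  obtain ⟨c, hc, p, hp⟩ := h
  exact ⟨c, hc, .cons hxy p, by simpa using hp⟩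

lemma Near.of_walk {C : Finset V} {x y : V} {i : ℕ} (h : Near G C i y) (p : G.Walk x y) :
    Near G C (p.length + i) x := by
  obtain ⟨c, hc, q, hq⟩ := h
  exact ⟨c, hc, p.append q, by simpa using hq⟩

lemma Near.mono {C : Finset V} {x : V} {i j : ℕ} (h : Near G C i x) (hij : i ≤ j) :
    Near G C j x := by
  obtain ⟨c, hc, p, hp⟩ := h
  exact ⟨c, hc, p, hp.trans hij⟩

lemma exists_adj_near {C : Finset V} {x : V} {i : ℕ} (h : Near G C (i + 1) x) (hx : x ∉ C) :
    ∃ y, G.Adj x y ∧ Near G C i y := by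
  obtain ⟨c, hc, p, hp⟩ := h
  cases p with
  | nil => exact absurd hc hx
  | cons hadj q => exact ⟨_, hadj, c, hc, q, by simpa using hp⟩

lemma exists_mem_of_isCycle_restrictTo {s : Set V} (hH : H ≤ restrictTo G s) {u : V}
    {c : H.Walk u u} (hc : c.IsCycle) : ∀ x ∈ c.support, x ∈ s := by
  classical
  intro x hx
  obtain ⟨σ, h1, h2⟩ := outOrientable_support hc
  obtain ⟨b, -, hb⟩ := h2 x (by simpa using hx)
  exact (hH (h1 x b hb).1).2.1

lemma exists_separated_core [Fintype V] [DecidableEq V] (G : SimpleGraph V) (M : ℕ) :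
    ∃ C : Finset V, OutOrientable G C ∧ PathBounded G M C ∧
      ∀ H : SimpleGraph V, H ≤ restrictTo G {x | ¬ Near G C 1 x} →
        ∀ (u : V) (c : H.Walk u u), c.IsCycle → M < c.length := by
  let P : Finset V → Prop := fun C => OutOrientable G C ∧ PathBounded G M C
  have h0 : P ∅ := by
    refine ⟨⟨fun _ _ => False, by simp, by simp⟩, ?_⟩
    intro l _ _ hl
    cases l with
    | nil => simp
    | cons a l => simpa using hl a
  obtain ⟨C, hC⟩ := (Set.toFinite {C | P C}).exists_maximal ⟨∅, h0⟩
  refine ⟨C, hC.1.1, hC.1.2, ?_⟩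
  intro H hH u c hc
  by_contra! hlen
  let c' : G.Walk u u := c.mapLe (hH.trans (restrictTo_le _))
  have hc' : c'.IsCycle := hc.mapLe _
  have hsupp : c'.support = c.support := by simp [c']
  have hlen' : c'.length = c.length := by simp [c']
  have hfar : ∀ x ∈ c'.support.toFinset, ¬ Near G C 1 x := by
    intro x hx
    rw [List.mem_toFinset, hsupp] at hx
    exact exists_mem_of_isCycle_restrictTo hH hc x hx
  have hP : P (C ∪ c'.support.toFinset) := by
    refine ⟨hC.1.1.union (outOrientable_support hc') ?_, hC.1.2.union ?_ ?_⟩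
    · rw [Finset.disjoint_left]
      exact fun x hx hx' => hfar x hx' ((near_zero.2 hx).mono zero_le_one)
    · exact (card_support_le hc').trans (hlen'.le.trans hlen)
    · exact fun a ha b hb hab => hfar b hb ((near_zero.2 ha).of_adj hab.symm)
  have hle := hC.2 hP subset_union_left
  have hu : u ∈ c'.support.toFinset := by simp
  exact hfar u hu ((near_zero.2 (hle (mem_union_right _ hu))).mono zero_le_one)

/-- A relation that lowers `f` outside `C` and never leaves `C` only has short simple paths. -/
lemma length_le_of_isChain {r : V → V → Prop} {C : Finset V} {f : V → ℕ} {M N : ℕ}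
    (hC : PathBounded G M C) (hrG : ∀ a b, r a b → G.Adj a b)
    (hstay : ∀ a b, a ∈ C → r a b → b ∈ C) (hf : ∀ a, a ∉ C → f a < N)
    (hdec : ∀ a b, a ∉ C → b ∉ C → r a b → f b < f a) (l : List V) (hnd : l.Nodup)
    (hch : l.IsChain r) : l.length ≤ N + M := by
  have hin : ∀ a l, a ∈ C → (a :: l).Nodup → (a :: l).IsChain r → (a :: l).length ≤ M := by
    intro a l ha hnd hch
    refine hC _ hnd (hch.imp hrG) (forall_mem_of_isChain (q := fun _ => True) ?_ l a hch ha ?_)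
    · exact fun x y hx _ hxy => hstay x y hx hxy
    · simp
  have hout : ∀ l a, a ∉ C → (a :: l).Nodup → (a :: l).IsChain r →
      (a :: l).length ≤ f a + 1 + M := by
    intro l
    induction l with
    | nil => intro a _ _ _; simp; omega
    | cons b l ih =>
      intro a ha hnd hch
      rw [List.isChain_cons_cons] at hch
      have hnd' := (List.nodup_cons.1 hnd).2
      rw [List.length_cons]
      by_cases hb : b ∈ C
      · have := hin b l hb hnd' hch.2
        omega
      · have := ih b hb hnd' hch.2
        have := hdec a b ha hb hch.1
        omega
  cases l with
  | nil => simp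
  | cons a l =>
    by_cases ha : a ∈ C
    · have := hin a l ha hnd hch
      omega
    · have := hout l a ha hnd hch
      have := hf a ha
      omega

/-- An orientation assembled from a core `C` and a potential `f` on its complement. -/
lemma exists_orientation [Fintype V] {C : Finset V} {f : V → ℕ} {M N : ℕ}
    (hO : OutOrientable G C) (hC : PathBounded G M C) (hf : ∀ a, a ∉ C → f a < N)
    (hne : ∀ a b, a ∉ C → b ∉ C → G.Adj a b → f a ≠ f b)
    (hout : ∀ a, a ∉ C → ∃ b, G.Adj a b ∧ (b ∈ C ∨ f b < f a)) :
    ∃ r : V → V → Prop, (∀ u v, r u v → G.Adj u v) ∧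
      (∀ u v, G.Adj u v → Xor (r u v) (r v u)) ∧ (∀ v, ∃ u, r v u) ∧
      ∀ l : List V, l.Nodup → l.IsChain r → l.length ≤ N + M := by
  classical
  obtain ⟨σ, hσ, hσout⟩ := hO
  let e := Fintype.equivFin V
  let r : V → V → Prop := fun a b => G.Adj a b ∧
    ((a ∈ C ∧ b ∈ C ∧ (σ a b ∨ (¬ σ b a ∧ e a < e b))) ∨ (a ∉ C ∧ b ∈ C) ∨
      (a ∉ C ∧ b ∉ C ∧ f b < f a))
  refine ⟨r, fun u v h => h.1, ?_, ?_, ?_⟩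
  · intro u v huv
    have h := huv.symm
    by_cases hu : u ∈ C <;> by_cases hv : v ∈ C
    · have h1 : σ u v → ¬ σ v u := fun h => (hσ u v h).2
      rcases lt_or_gt_of_ne (e.injective.ne huv.ne) with h2 | h2 <;>
        by_cases h3 : σ u v <;> by_cases h4 : σ v u <;>
        simp_all [r, Xor, h2.le]
    · simp [r, hu, hv, huv, h, Xor]
    · simp [r, hu, hv, huv, h, Xor]
    · rcases lt_or_gt_of_ne (hne u v hu hv huv) with h1 | h1 <;>
        simp [r, hu, hv, huv, h, h1, h1.le, Xor]
  · intro v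
    by_cases hv : v ∈ C
    · obtain ⟨b, hb, h⟩ := hσout v hv
      exact ⟨b, (hσ v b h).1, Or.inl ⟨hv, hb, Or.inl h⟩⟩
    · obtain ⟨b, hb, h⟩ := hout v hv
      by_cases hbC : b ∈ C
      · exact ⟨b, hb, Or.inr (Or.inl ⟨hv, hbC⟩)⟩
      · exact ⟨b, hb, Or.inr (Or.inr ⟨hv, hbC, h.resolve_left hbC⟩)⟩
  · refine length_le_of_isChain (f := f) hC (fun a b h => h.1) ?_ hf ?_
    · rintro a b ha ⟨-, h | h | h⟩
      · exact h.2.1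
      · exact h.2
      · exact absurd ha h.1
    · rintro a b ha hb ⟨-, h | h | h⟩
      · exact absurd h.1 ha
      · exact absurd h.2 hb
      · exact h.2.2

/-- If everything is within distance `L + 1` of `C`, then an `m`-coloring of `G` and a
`k`-coloring of the vertices at distance at least two from `C` combine to a potential. -/
lemma exists_potential [DecidableEq V] {C : Finset V} {L m k : ℕ} (hnear : ∀ x, Near G C (L + 1) x)
    {col c : V → ℕ} (hcolm : ∀ x, col x < m) (hcol : ∀ x y, G.Adj x y → col x ≠ col y)
    (hck : ∀ x, c x < k)
    (hc : ∀ x y, (restrictTo G {x | ¬ Near G C 1 x}).Adj x y → c x ≠ c y) :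
    ∃ f : V → ℕ, (∀ a, a ∉ C → f a < m + k * L) ∧
      (∀ a b, a ∉ C → b ∉ C → G.Adj a b → f a ≠ f b) ∧
      (∀ a, a ∉ C → ∃ b, G.Adj a b ∧ (b ∈ C ∨ f b < f a)) := by
  classical
  have hex : ∀ x, ∃ i, Near G C i x := fun x => ⟨_, hnear x⟩
  let lev : V → ℕ := fun x => Nat.find (hex x)
  have hlev : ∀ x, Near G C (lev x) x := fun x => Nat.find_spec (hex x)
  have hlev_le : ∀ x i, Near G C i x → lev x ≤ i := fun x i h => Nat.find_min' (hex x) h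
  have hpos : ∀ x, x ∉ C → 1 ≤ lev x := by
    intro x hx
    by_contra! h
    have h' := hlev x
    rw [Nat.lt_one_iff.1 h, near_zero] at h'
    exact hx h'
  have hfar : ∀ x, 2 ≤ lev x → ¬ Near G C 1 x := fun x h h' => by
    have := hlev_le x 1 h'
    omega
  let f : V → ℕ := fun x => if lev x ≤ 1 then col x else m + (k * (lev x - 2) + c x)
  have hf_lt : ∀ x y, lev x < lev y → 1 ≤ lev x → f x < f y := by
    intro x y hxy hx
    have hy : ¬ lev y ≤ 1 := by omega
    by_cases h : lev x ≤ 1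
    · have := hcolm x
      simp only [f, h, hy, if_true, if_false]
      omega
    · simp only [f, h, hy, if_false]
      have h1 := hck x
      have h2 : k * (lev x - 2) + k ≤ k * (lev y - 2) := by
        rw [← Nat.mul_succ]
        exact Nat.mul_le_mul_left _ (by omega)
      omega
  refine ⟨f, ?_, ?_, ?_⟩
  · intro a _
    by_cases h : lev a ≤ 1
    · have := hcolm a
      simp only [f, h, if_true]
      omega
    · simp only [f, h, if_false]
      have h1 := hck a
      have h2 := hlev_le a _ (hnear a)
      have h3 : k * (lev a - 2) + k ≤ k * L := by
        rw [← Nat.mul_succ]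
        exact Nat.mul_le_mul_left _ (by omega)
      omega
  · intro a b ha hb hab
    rcases lt_trichotomy (lev a) (lev b) with h | h | h
    · exact (hf_lt a b h (hpos a ha)).ne
    · by_cases h1 : lev b ≤ 1
      · simpa [f, h, h1] using hcol a b hab
      · have := hc a b ⟨hab, hfar a (by omega), hfar b (by omega)⟩
        simpa [f, h, h1] using this
    · exact (hf_lt b a h (hpos b hb)).ne'
  · intro a ha
    have h1 := hpos a ha
    have h2 := hlev a
    rw [← Nat.sub_add_cancel h1] at h2
    obtain ⟨b, hab, hb⟩ := exists_adj_near h2 ha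
    have := hlev_le b _ hb
    refine ⟨b, hab, or_iff_not_imp_left.2 fun hbC => hf_lt b a (by omega) (hpos b hbC)⟩

end ShortOrientation


/-- Explicit form of the short-orientation lemma: a finite simple graph `G` on
`n ≥ 2` vertices with minimum degree `δ ≥ 3` admits, for every integer `k`
with `3 ≤ k ≤ δ`, an orientation in which every vertex has out-degree at least
one and every directed simple path has at most
`χ(G) + k⌈log_{δ-1} n⌉ + 2⌈log_{k-1} n⌉` vertices. An orientation is a
relation `r` such that `r u v` implies adjacency and for each edge exactly one
direction holds; a directed simple path is a duplicate-free list chained by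
`r`. -/
theorem short_orientation {V : Type} [Fintype V] [DecidableEq V]
    (G : SimpleGraph V) [DecidableRel G.Adj]
    (δ k : ℕ) (hδ : 3 ≤ δ) (hk : 3 ≤ k) (hkδ : k ≤ δ)
    (hn : 2 ≤ Fintype.card V)
    (hdeg : ∀ w : V, δ ≤ G.degree w) :
    ∃ r : V → V → Prop,
      (∀ u v, r u v → G.Adj u v) ∧
      (∀ u v, G.Adj u v → Xor' (r u v) (r v u)) ∧
      (∀ v : V, ∃ u : V, r v u) ∧
      (∀ l : List V, l.Nodup → l.Chain' r →
        (l.length : ℕ∞) ≤ G.chromaticNumber +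
          ((k * Nat.clog (δ - 1) (Fintype.card V) +
            2 * Nat.clog (k - 1) (Fintype.card V) : ℕ) : ℕ∞)) := by
  classical
  set n := Fintype.card V with hn_def
  set L := Nat.clog (δ - 1) n with hL
  set T := Nat.clog (k - 1) n with hT
  have hLT : L ≤ T := Nat.clog_anti_left (by omega) (by omega)
  have hLpos : 0 < L := Nat.clog_pos (by omega) (by omega)
  obtain ⟨C, hO, hC, hgirth⟩ := ShortOrientation.exists_separated_core G (2 * T)
  set U : Set V := {x | ¬ ShortOrientation.Near G C 1 x} with hU
  have hnear : ∀ x, ShortOrientation.Near G C (L + 1) x := by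
    intro v
    by_contra hv
    obtain ⟨u, c, hc, hlen⟩ := ShortOrientation.exists_isCycle_length_le
      (H := ShortOrientation.restrictTo G U) v (d := δ) hLpos
      (Nat.le_pow_clog (by omega) n) (by
        intro x hx hxL
        refine (hdeg x).trans ?_
        rw [← SimpleGraph.card_neighborFinset_eq_degree]
        refine Finset.card_le_card fun y hy => ?_
        rw [SimpleGraph.mem_neighborFinset] at hy
        rw [Finset.mem_filter]
        obtain ⟨p, hp⟩ := hx.exists_walk_length_eq_dist
        let q : G.Walk v x := p.mapLe (ShortOrientation.restrictTo_le U)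
        have hq : q.length < L := by simpa [q, hp] using hxL
        refine ⟨Finset.mem_univ _, hy, fun h => hv ((h.of_walk q).mono (by omega)), fun h => ?_⟩
        refine hv ((h.of_walk (q.concat hy)).mono ?_)
        rw [SimpleGraph.Walk.length_concat]
        omega)
    have := hgirth _ le_rfl u c hc
    omega
  obtain ⟨c, hck, hc⟩ := ShortOrientation.exists_coloring_of_degenerate
    (H := ShortOrientation.restrictTo G U) (k := k) (by
      intro W hW
      by_contra! hdegW
      obtain ⟨v, hv⟩ := hW
      let J := ShortOrientation.restrictTo (ShortOrientation.restrictTo G U) (W : Set V)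
      obtain ⟨u, p, hp, hlen⟩ := ShortOrientation.exists_isCycle_length_le
        (H := J) v (d := k) (R := T) (by omega) (Nat.le_pow_clog (by omega) n) (by
          intro x hx _
          have hxW : x ∈ W := by
            obtain ⟨p⟩ := hx.symm
            cases p with
            | nil => exact hv
            | cons h _ => exact h.2.1
          refine (hdegW x hxW).trans (Finset.card_le_card fun y hy => ?_)
          rw [Finset.mem_filter] at hy ⊢
          exact ⟨Finset.mem_univ _, hy.2, hxW, hy.1⟩)
      have := hgirth J (ShortOrientation.restrictTo_le _) u p hp
      omega)
  have hcolorable := G.colorable_chromaticNumber_of_fintype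
  obtain ⟨col⟩ := hcolorable
  obtain ⟨f, hf, hne, hout⟩ := ShortOrientation.exists_potential hnear
    (col := fun x => (col x : ℕ)) (fun x => (col x).isLt)
    (fun x y h h' => col.valid h (Fin.ext h')) hck hc
  obtain ⟨r, h1, h2, h3, h4⟩ := ShortOrientation.exists_orientation hO hC hf hne hout
  refine ⟨r, h1, h2, h3, fun l hl hch => ?_⟩
  have hχ : ((ENat.toNat G.chromaticNumber : ℕ) : ℕ∞) = G.chromaticNumber :=
    ENat.natCast_toNat (SimpleGraph.chromaticNumber_ne_top_iff_exists.2 ⟨_, ⟨col⟩⟩)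
  rw [← hχ]
  have := h4 l hl hch
  norm_cast
  omega
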